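/- Fix an integer ν ≥ 4, and let η(ν) be the unique root in the interval (1/(ν−1), 2·log ν/(ν−1)) of the equation e^{(ν−1)η} = ν·e·η. Suppose M = M(n) is a sequence of positive integers with M(n) → ∞ and log M(n) = O(n), and suppose n/log M(n) converges to a limit κ with κ ∈ (2/η(ν), ∞) \ {2(ν−1)}. Then, with c_M := M^{−2}·E[X²] = (M+1)(2M+1)/(6M²), one has E[Z_n] = (1+o(1)) · (ν^n / M^{ν−1}) · ν^{ν−3/2} / (2π·ν·c_M·n)^{(ν−1)/2} as n → ∞; in particular E[Z_n] → ∞. -/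

import Mathlib

open Filter

/-- The number of perfect ordered partitions of `{1,…,n}` into `ν` nonempty parts. -/
noncomputable def perfectCount (ν n : ℕ) (X : Fin n → ℕ) : ℕ :=
  Set.ncard {σ : Fin n → Fin ν | Function.Surjective σ ∧
    ∀ α β : Fin ν,
      (∑ j ∈ Finset.univ.filter fun j => σ j = α, X j) =
      (∑ j ∈ Finset.univ.filter fun j => σ j = β, X j)}

/-- `E[Z_n]` for `X_1,…,X_n` i.i.d. uniform on `{1,…,M}`. -/
noncomputable def EZ (ν n M : ℕ) : ℝ :=
  (∑ X : Fin n → Fin M, ((perfectCount ν n fun j => (X j : ℕ) + 1) : ℝ)) / (M : ℝ) ^ n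

/-- `c_M = M⁻²·E[X²] = (M+1)(2M+1)/(6M²)` for `X` uniform on `{1,…,M}`. -/
noncomputable def cM (M : ℕ) : ℝ := ((M : ℝ) + 1) * (2 * (M : ℝ) + 1) / (6 * (M : ℝ) ^ 2)

open MeasureTheory

/-- The characteristic function of the uniform distribution on `{1,…,M}`. -/
noncomputable def unifChar (M : ℕ) (t : ℝ) : ℂ :=
  (∑ x : Fin M, Complex.exp (((((x : ℕ) : ℝ) + 1) * t : ℝ) * Complex.I)) / M

lemma norm_unifChar_le_one (M : ℕ) (t : ℝ) : ‖unifChar M t‖ ≤ 1 := by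
  rw [unifChar, norm_div, Complex.norm_natCast]
  refine div_le_one_of_le₀ ((norm_sum_le _ _).trans ?_) (Nat.cast_nonneg M)
  simp only [Complex.norm_exp_ofReal_mul_I]
  simp

lemma continuous_unifChar (M : ℕ) : Continuous (unifChar M) := by
  unfold unifChar
  fun_prop

lemma norm_sq_sum_exp_mul_I {ι : Type*} (s : Finset ι) (a : ι → ℝ) :
    ‖∑ j ∈ s, Complex.exp (a j * Complex.I)‖ ^ 2 = ∑ j ∈ s, ∑ k ∈ s, Real.cos (a j - a k) := by
  rw [← Complex.normSq_eq_norm_sq, Complex.normSq_apply]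
  simp only [Complex.re_sum, Complex.im_sum, Complex.exp_ofReal_mul_I_re,
    Complex.exp_ofReal_mul_I_im, Finset.sum_mul_sum, Real.cos_sub, Finset.sum_add_distrib]

lemma div_three_le_sin {y : ℝ} (h0 : 0 ≤ y) (h2 : y ≤ 2) : y / 3 ≤ Real.sin y := by
  have hpi := Real.pi_gt_three
  have hpi' := Real.pi_lt_d2
  have hinv : 2 / 3.15 ≤ 2 / Real.pi := by gcongr
  rcases le_total y (Real.pi / 2) with h | h
  · have := Real.mul_le_sin h0 h
    norm_num at hinv
    nlinarith
  · have := Real.mul_le_sin (x := Real.pi - y) (by linarith) (by linarith)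
    rw [Real.sin_pi_sub] at this
    have h3 : 2 / Real.pi * (Real.pi - y) = 2 - 2 / Real.pi * y := by field_simp
    have h4 : 2 / Real.pi ≤ 2 / 3 := by gcongr
    nlinarith

lemma sq_div_le_one_sub_cos {u : ℝ} (h : |u| ≤ 4) : u ^ 2 / 18 ≤ 1 - Real.cos u := by
  have h1 : Real.cos u = 1 - 2 * Real.sin (|u| / 2) ^ 2 := by
    rw [← Real.cos_abs, Real.sin_sq_eq_half_sub]
    ring_nf
  have h2 := div_three_le_sin (y := |u| / 2) (by positivity) (by linarith)
  have h3 : (|u| / 2 / 3) ^ 2 ≤ Real.sin (|u| / 2) ^ 2 := by gcongr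
  rw [h1]
  have := sq_abs u
  nlinarith

lemma sum_sum_sub_sq (M : ℕ) :
    ∑ j : Fin M, ∑ k : Fin M, (((j : ℕ) : ℝ) - ((k : ℕ) : ℝ)) ^ 2
      = (M : ℝ) ^ 2 * ((M : ℝ) ^ 2 - 1) / 6 := by
  have h1 : ∑ j : Fin M, ((j : ℕ) : ℝ) = M * (M - 1) / 2 := by
    rw [Fin.sum_univ_eq_sum_range (fun j => (j : ℝ))]
    induction M with
    | zero => simp
    | succ M ih => rw [Finset.sum_range_succ, ih]; push_cast; ring
  have h2 : ∑ j : Fin M, ((j : ℕ) : ℝ) ^ 2 = M * (M - 1) * (2 * M - 1) / 6 := by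
    rw [Fin.sum_univ_eq_sum_range (fun j => (j : ℝ) ^ 2)]
    clear h1
    induction M with
    | zero => simp
    | succ M ih => rw [Finset.sum_range_succ, ih]; push_cast; ring
  simp only [sub_sq, Finset.sum_add_distrib, Finset.sum_sub_distrib, ← Finset.mul_sum,
    ← Finset.sum_mul, h1, h2, Finset.sum_const, Finset.card_univ, Fintype.card_fin, nsmul_eq_mul]
  ring

lemma norm_unifChar_mul_le (M : ℕ) (hM : 1 ≤ M) {t : ℝ} (ht : |t| ≤ Real.pi) :
    ‖unifChar M t‖ * (M * |t|) ≤ Real.pi := by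
  have hMpos : (0 : ℝ) < M := by exact_mod_cast hM
  have hgeom : (∑ x : Fin M, Complex.exp (((((x : ℕ) : ℝ) + 1) * t : ℝ) * Complex.I))
      * (Complex.exp (Complex.I * t) - 1)
      = Complex.exp (Complex.I * t) * (Complex.exp (Complex.I * t) ^ M - 1) := by
    rw [← geom_sum_mul, ← mul_assoc, Finset.mul_sum, ← Fin.sum_univ_eq_sum_range
      (fun x => Complex.exp (Complex.I * t) * Complex.exp (Complex.I * t) ^ x)]
    congr 1
    refine Finset.sum_congr rfl fun x _ => ?_
    rw [← Complex.exp_nat_mul, ← Complex.exp_add]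
    congr 1
    push_cast
    ring
  have hone : ‖Complex.exp (Complex.I * t)‖ = 1 := by
    rw [mul_comm, Complex.norm_exp_ofReal_mul_I]
  have hnorm := congrArg norm hgeom
  rw [norm_mul, norm_mul, hone, one_mul, Complex.norm_exp_I_mul_ofReal_sub_one] at hnorm
  have hle : ‖Complex.exp (Complex.I * t) ^ M - 1‖ ≤ 2 := by
    refine (norm_sub_le _ _).trans ?_
    rw [norm_pow, hone]
    norm_num
  have hsin : |t| / Real.pi ≤ |Real.sin (t / 2)| := by
    have h := Real.mul_le_sin (x := |t| / 2) (by positivity) (by linarith)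
    have habs : |Real.sin (t / 2)| = |Real.sin (|t| / 2)| := by
      rcases abs_cases t with ⟨h, -⟩ | ⟨h, -⟩ <;> rw [h]
      rw [neg_div, Real.sin_neg, abs_neg]
    rw [habs]
    refine le_trans (le_of_eq ?_) (h.trans (le_abs_self _))
    ring
  set S := ∑ x : Fin M, Complex.exp (((((x : ℕ) : ℝ) + 1) * t : ℝ) * Complex.I) with hS
  have hpsi : ‖unifChar M t‖ * (M * |t|) = ‖S‖ * |t| := by
    rw [unifChar, ← hS, norm_div, Complex.norm_natCast]
    field_simp
  rw [hpsi]
  rw [norm_mul, Real.norm_eq_abs, Real.norm_eq_abs, abs_two] at hnorm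
  have hpi := Real.pi_pos
  rw [div_le_iff₀ hpi] at hsin
  have h1 : ‖S‖ * |t| ≤ ‖S‖ * (|Real.sin (t / 2)| * Real.pi) := by gcongr
  nlinarith

lemma norm_unifChar_sq_mul_le_one (M : ℕ) (hM : 2 ≤ M) {t : ℝ} (ht : |t| ≤ Real.pi) :
    ‖unifChar M t‖ ^ 2 * (1 + (M * t) ^ 2 / 144) ≤ 1 := by
  have hM2 : (2 : ℝ) ≤ M := by exact_mod_cast hM
  have hMpos : (0 : ℝ) < M := by linarith
  rcases le_total (M * |t|) 4 with h | h
  · have hsq : ‖unifChar M t‖ ^ 2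
        = (∑ j : Fin M, ∑ k : Fin M, Real.cos ((((j : ℕ) : ℝ) - ((k : ℕ) : ℝ)) * t))
          / (M : ℝ) ^ 2 := by
      rw [unifChar, norm_div, div_pow, Complex.norm_natCast, norm_sq_sum_exp_mul_I]
      congr 1
      refine Finset.sum_congr rfl fun j _ => Finset.sum_congr rfl fun k _ => ?_
      congr 1
      ring
    have hsum : ∑ j : Fin M, ∑ k : Fin M, Real.cos ((((j : ℕ) : ℝ) - ((k : ℕ) : ℝ)) * t)
        ≤ ∑ j : Fin M, ∑ k : Fin M,
          (1 - (((j : ℕ) : ℝ) - ((k : ℕ) : ℝ)) ^ 2 * (t ^ 2 / 18)) := by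
      refine Finset.sum_le_sum fun j _ => Finset.sum_le_sum fun k _ => ?_
      have hjk : |((j : ℕ) : ℝ) - ((k : ℕ) : ℝ)| ≤ M := by
        have hj : ((j : ℕ) : ℝ) ≤ M := by exact_mod_cast j.2.le
        have hk : ((k : ℕ) : ℝ) ≤ M := by exact_mod_cast k.2.le
        have hj0 : (0 : ℝ) ≤ ((j : ℕ) : ℝ) := by positivity
        have hk0 : (0 : ℝ) ≤ ((k : ℕ) : ℝ) := by positivity
        rw [abs_le]
        constructor <;> linarith
      have := sq_div_le_one_sub_cos (u := (((j : ℕ) : ℝ) - ((k : ℕ) : ℝ)) * t) (by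
        rw [abs_mul]
        exact (mul_le_mul_of_nonneg_right hjk (abs_nonneg t)).trans h)
      rw [mul_pow] at this
      linarith
    simp only [Finset.sum_sub_distrib, ← Finset.sum_mul, sum_sum_sub_sq, Finset.sum_const,
      Finset.card_univ, Fintype.card_fin, nsmul_eq_mul, mul_one] at hsum
    have hle : ‖unifChar M t‖ ^ 2 ≤ 1 - (M * t) ^ 2 / 144 := by
      rw [hsq, div_le_iff₀ (by positivity)]
      refine hsum.trans ?_
      have : 0 ≤ (M : ℝ) ^ 2 * t ^ 2 * ((M : ℝ) ^ 2 - 4) := by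
        have : 0 ≤ (M : ℝ) ^ 2 - 4 := by nlinarith
        positivity
      nlinarith
    calc ‖unifChar M t‖ ^ 2 * (1 + (M * t) ^ 2 / 144)
        ≤ (1 - (M * t) ^ 2 / 144) * (1 + (M * t) ^ 2 / 144) := by gcongr
      _ ≤ 1 := by nlinarith [sq_nonneg ((M * t) ^ 2 / 144)]
  · have h1 := norm_unifChar_mul_le M (by omega) ht
    have hpi := Real.pi_lt_d2
    have hpi0 := Real.pi_pos
    have h2 : (‖unifChar M t‖ * (M * |t|)) ^ 2 ≤ 3.15 ^ 2 := by
      gcongr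
      exact h1.trans hpi.le
    have h3 : (M * t) ^ 2 = (M * |t|) ^ 2 := by rw [mul_pow, mul_pow, sq_abs]
    rw [mul_pow] at h2
    rw [h3]
    have h4 : 16 ≤ (M * |t|) ^ 2 := by nlinarith
    have h5 := mul_le_mul_of_nonneg_left h4 (sq_nonneg ‖unifChar M t‖)
    norm_num at h2
    nlinarith

lemma norm_unifChar_pow_le (M : ℕ) (hM : 2 ≤ M) {t : ℝ} (ht : |t| ≤ Real.pi) (h : ℕ) :
    ‖unifChar M t‖ ^ (2 * h) ≤ (1 + h * ((M * t) ^ 2 / 144))⁻¹ := by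
  have h1 := norm_unifChar_sq_mul_le_one M hM ht
  have h0 : 0 ≤ (M * t) ^ 2 / 144 := by positivity
  rw [pow_mul, ← one_div, le_div_iff₀ (by positivity)]
  calc (‖unifChar M t‖ ^ 2) ^ h * (1 + h * ((M * t) ^ 2 / 144))
      ≤ (‖unifChar M t‖ ^ 2) ^ h * (1 + (M * t) ^ 2 / 144) ^ h := by
        gcongr
        exact one_add_mul_le_pow (by linarith) h
    _ = (‖unifChar M t‖ ^ 2 * (1 + (M * t) ^ 2 / 144)) ^ h := (mul_pow _ _ _).symm
    _ ≤ 1 := pow_le_one₀ (by positivity) h1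

lemma sum_fin_succ_cast (M : ℕ) : ∑ x : Fin M, (((x : ℕ) : ℝ) + 1) = (M : ℝ) * (M + 1) / 2 := by
  rw [Fin.sum_univ_eq_sum_range (fun x => (x : ℝ) + 1)]
  induction M with
  | zero => simp
  | succ M ih => rw [Finset.sum_range_succ, ih]; push_cast; ring

lemma sum_fin_succ_cast_sq (M : ℕ) :
    ∑ x : Fin M, (((x : ℕ) : ℝ) + 1) ^ 2 = (M : ℝ) * (M + 1) * (2 * M + 1) / 6 := by
  rw [Fin.sum_univ_eq_sum_range (fun x => ((x : ℝ) + 1) ^ 2)]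
  induction M with
  | zero => simp
  | succ M ih => rw [Finset.sum_range_succ, ih]; push_cast; ring

lemma norm_exp_ofReal_mul_I_sub_taylor_le {y : ℝ} (hy : |y| ≤ 1) :
    ‖Complex.exp (y * Complex.I) - (1 + y * Complex.I - y ^ 2 / 2)‖ ≤ |y| ^ 3 := by
  have hn : ‖(y : ℂ) * Complex.I‖ = |y| := by simp
  have h := Complex.exp_bound (x := y * Complex.I) (by rw [hn]; exact hy) (n := 3) (by norm_num)
  rw [hn] at h
  have h2 : ∑ m ∈ Finset.range 3, ((y : ℂ) * Complex.I) ^ m / (m.factorial : ℂ)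
      = 1 + y * Complex.I - y ^ 2 / 2 := by
    simp [Finset.sum_range_succ, mul_pow]
    ring
  rw [h2] at h
  refine h.trans ?_
  have h3 : ((Nat.succ 3 : ℕ) : ℝ) * (((Nat.factorial 3 : ℕ) : ℝ) * (3 : ℕ))⁻¹ ≤ 1 := by
    norm_num [Nat.factorial]
  exact mul_le_of_le_one_right (by positivity) h3

lemma norm_unifChar_sub_taylor_le (M : ℕ) (hM : 1 ≤ M) {t : ℝ} (ht : M * |t| ≤ 1) :
    ‖unifChar M t - (1 + ((M + 1) / 2 * t : ℝ) * Complex.I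
      - ((cM M * (M * t) ^ 2 / 2 : ℝ) : ℂ))‖ ≤ (M * |t|) ^ 3 := by
  have hMpos : (0 : ℝ) < M := by exact_mod_cast hM
  have hM0 : (M : ℂ) ≠ 0 := by exact_mod_cast hMpos.ne'
  have hsum : (∑ x : Fin M, (1 + ((((x : ℕ) : ℝ) + 1) * t : ℝ) * Complex.I
        - ((((((x : ℕ) : ℝ) + 1) * t : ℝ)) : ℂ) ^ 2 / 2)) / M
      = 1 + ((M + 1) / 2 * t : ℝ) * Complex.I - ((cM M * (M * t) ^ 2 / 2 : ℝ) : ℂ) := by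
    have h1 : ∑ x : Fin M, ((((((x : ℕ) : ℝ) + 1) * t : ℝ)) : ℂ)
        = ((M * (M + 1) / 2 * t : ℝ) : ℂ) := by
      rw [← Complex.ofReal_sum, ← Finset.sum_mul, sum_fin_succ_cast]
    have h2 : ∑ x : Fin M, ((((((x : ℕ) : ℝ) + 1) * t : ℝ)) : ℂ) ^ 2
        = ((M * (M + 1) * (2 * M + 1) / 6 * t ^ 2 : ℝ) : ℂ) := by
      rw [← sum_fin_succ_cast_sq, Finset.sum_mul]
      push_cast
      exact Finset.sum_congr rfl fun x _ => by ring
    rw [Finset.sum_sub_distrib, Finset.sum_add_distrib, ← Finset.sum_mul, ← Finset.sum_div, h1, h2]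
    simp only [Finset.sum_const, Finset.card_univ, Fintype.card_fin, nsmul_eq_mul, mul_one, cM]
    push_cast
    field_simp
  rw [← hsum, unifChar, ← sub_div, ← Finset.sum_sub_distrib, norm_div, Complex.norm_natCast,
    div_le_iff₀ hMpos]
  calc _ ≤ ∑ _x : Fin M, (M * |t|) ^ 3 := by
        refine norm_sum_le_of_le _ fun x _ => ?_
        have hx : |(((x : ℕ) : ℝ) + 1) * t| ≤ M * |t| := by
          rw [abs_mul, abs_of_nonneg (by positivity)]
          gcongr
          exact_mod_cast x.2
        exact (norm_exp_ofReal_mul_I_sub_taylor_le (hx.trans ht)).trans (by gcongr)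
    _ = (M * |t|) ^ 3 * M := by simp [mul_comm]

lemma tendsto_cM : Tendsto cM atTop (nhds (1 / 3)) := by
  have h : Tendsto (fun M : ℕ => (1 + (M : ℝ)⁻¹) * (2 + (M : ℝ)⁻¹) / 6) atTop
      (nhds ((1 + 0) * (2 + 0) / 6)) :=
    ((tendsto_const_nhds.add tendsto_inv_atTop_nhds_zero_nat).mul
      (tendsto_const_nhds.add tendsto_inv_atTop_nhds_zero_nat)).div_const _
  norm_num at h
  refine (h.congr' ?_).trans (by norm_num)
  filter_upwards [eventually_gt_atTop 0] with M hM
  have : (M : ℝ) ≠ 0 := by exact_mod_cast hM.ne'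
  rw [cM]
  field_simp

/-- The second-order term of the characteristic function at the scale `M√n`. -/
lemma tendsto_mul_unifChar_sub (M : ℕ → ℕ) (hM1 : ∀ n, 1 ≤ M n) (hM : Tendsto M atTop atTop)
    (x : ℝ) :
    Tendsto (fun n : ℕ => (n : ℂ) * (unifChar (M n) ((M n * √n)⁻¹ * x) - 1
      - (((M n + 1) / 2 * ((M n * √n)⁻¹ * x) : ℝ) : ℂ) * Complex.I)) atTop
      (nhds ((-(x ^ 2 / 6) : ℝ) : ℂ)) := by
  have hmain : Tendsto (fun n : ℕ => ((-(cM (M n) * x ^ 2 / 2) : ℝ) : ℂ)) atTop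
      (nhds ((-(x ^ 2 / 6) : ℝ) : ℂ)) := by
    have h := (((tendsto_cM.comp hM).mul_const (x ^ 2)).div_const 2).neg
    have e : -(1 / 3 * x ^ 2 / 2) = -(x ^ 2 / 6) := by ring
    rw [e] at h
    exact (Complex.continuous_ofReal.tendsto _).comp h
  have hsqrt : Tendsto (fun n : ℕ => √(n : ℝ)) atTop atTop :=
    Real.tendsto_sqrt_atTop.comp tendsto_natCast_atTop_atTop
  have herr : Tendsto (fun n : ℕ => |x| ^ 3 * (√(n : ℝ))⁻¹) atTop (nhds 0) := by
    simpa using (tendsto_inv_atTop_zero.comp hsqrt).const_mul (|x| ^ 3)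
  refine tendsto_of_tendsto_of_dist hmain (squeeze_zero' (Eventually.of_forall fun _ => dist_nonneg)
    ?_ herr)
  filter_upwards [hsqrt.eventually_ge_atTop (max 1 |x|)] with n hn
  have hs1 : 1 ≤ √(n : ℝ) := (le_max_left _ _).trans hn
  have hsx : |x| ≤ √(n : ℝ) := (le_max_right _ _).trans hn
  have hs0 : 0 < √(n : ℝ) := by linarith
  have hMpos : (0 : ℝ) < M n := by exact_mod_cast hM1 n
  have habs : M n * |(M n * √n)⁻¹ * x| = |x| * (√(n : ℝ))⁻¹ := by
    rw [abs_mul, abs_of_nonneg (a := ((M n : ℝ) * √n)⁻¹) (by positivity)]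
    field_simp
  have ht := norm_unifChar_sub_taylor_le (M n) (hM1 n) (t := (M n * √n)⁻¹ * x) (by
    rw [habs, ← div_eq_mul_inv]
    exact div_le_one_of_le₀ hsx hs0.le)
  rw [habs] at ht
  have hnn : (n : ℝ) = √n ^ 2 := (Real.sq_sqrt (by positivity)).symm
  have hsplit : ((-(cM (M n) * x ^ 2 / 2) : ℝ) : ℂ)
      = (n : ℂ) * (-((cM (M n) * (M n * ((M n * √n)⁻¹ * x)) ^ 2 / 2 : ℝ) : ℂ)) := by
    have : -(cM (M n) * x ^ 2 / 2)
        = (n : ℝ) * (-(cM (M n) * (M n * ((M n * √n)⁻¹ * x)) ^ 2 / 2)) := by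
      field_simp
      rw [Real.sq_sqrt (by positivity)]
    rw [this]
    push_cast
    ring
  rw [dist_comm, dist_eq_norm, hsplit, ← mul_sub, norm_mul, Complex.norm_natCast]
  calc _ = (n : ℝ) * ‖unifChar (M n) ((M n * √n)⁻¹ * x)
          - (1 + ((M n + 1) / 2 * ((M n * √n)⁻¹ * x) : ℝ) * Complex.I
          - ((cM (M n) * (M n * ((M n * √n)⁻¹ * x)) ^ 2 / 2 : ℝ) : ℂ))‖ := by
        congr 2
        ring
    _ ≤ (n : ℝ) * (|x| * (√(n : ℝ))⁻¹) ^ 3 := by gcongr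
    _ = |x| ^ 3 * (√(n : ℝ))⁻¹ := by
        nth_rewrite 1 [hnn]
        field_simp

/-- Extends `θ` by one last coordinate so that the coordinates sum to zero. -/
noncomputable def zeroSumExt {k : ℕ} (θ : Fin k → ℝ) : Fin (k + 1) → ℝ :=
  Fin.snoc (α := fun _ => ℝ) θ (-∑ i, θ i)

lemma zeroSumExt_castSucc {k : ℕ} (θ : Fin k → ℝ) (i : Fin k) :
    zeroSumExt θ i.castSucc = θ i := by
  simp [zeroSumExt]

lemma zeroSumExt_last {k : ℕ} (θ : Fin k → ℝ) :
    zeroSumExt θ (Fin.last k) = -∑ i, θ i := by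
  simp [zeroSumExt]

lemma sum_zeroSumExt {k : ℕ} (θ : Fin k → ℝ) : ∑ α, zeroSumExt θ α = 0 := by
  simp [Fin.sum_univ_castSucc, zeroSumExt_castSucc, zeroSumExt_last]

lemma zeroSumExt_smul {k : ℕ} (r : ℝ) (θ : Fin k → ℝ) (α : Fin (k + 1)) :
    zeroSumExt (r • θ) α = r * zeroSumExt θ α := by
  refine Fin.lastCases ?_ (fun i => ?_) α
  · simp [zeroSumExt_last, Finset.mul_sum]
  · simp [zeroSumExt_castSucc]

lemma continuous_zeroSumExt {k : ℕ} (α : Fin (k + 1)) :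
    Continuous fun θ : Fin k → ℝ => zeroSumExt θ α := by
  refine Fin.lastCases ?_ (fun i => ?_) α
  · simp only [zeroSumExt_last]
    fun_prop
  · simp only [zeroSumExt_castSucc]
    fun_prop

/-- The sum of the weights in block `α`. -/
def blockSum {ν n : ℕ} (σ : Fin n → Fin ν) (X : Fin n → ℕ) (α : Fin ν) : ℕ :=
  ∑ j ∈ Finset.univ.filter fun j => σ j = α, X j

/-- All blocks of the assignment `σ` have the same sum. -/
def EqualBlockSums {ν n : ℕ} (σ : Fin n → Fin ν) (X : Fin n → ℕ) : Prop :=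
  ∀ α β : Fin ν, blockSum σ X α = blockSum σ X β

open Classical in
/-- The probability that `σ` is balanced when the weights are i.i.d. uniform on `{1,…,M}`. -/
noncomputable def balancedProb {ν n : ℕ} (M : ℕ) (σ : Fin n → Fin ν) : ℝ :=
  ((Finset.univ.filter fun X : Fin n → Fin M => EqualBlockSums σ fun j => (X j : ℕ) + 1).card : ℝ)
    / (M : ℝ) ^ n

lemma balancedProb_nonneg {ν n : ℕ} (M : ℕ) (σ : Fin n → Fin ν) : 0 ≤ balancedProb M σ := by
  unfold balancedProb
  positivity

open Classical in
lemma EZ_eq_sum_balancedProb (ν n M : ℕ) :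
    EZ ν n M = ∑ σ : Fin n → Fin ν with Function.Surjective σ, balancedProb M σ := by
  have h : ∀ X : Fin n → ℕ, (perfectCount ν n X : ℝ)
      = ∑ σ : Fin n → Fin ν with Function.Surjective σ, if EqualBlockSums σ X then (1 : ℝ) else 0 := by
    intro X
    rw [Finset.sum_boole, perfectCount, Finset.filter_filter, ← Set.ncard_coe_finset,
      Finset.coe_filter_univ]
    rfl
  simp only [EZ, balancedProb, h, ← Finset.sum_div]
  rw [Finset.sum_comm]
  simp only [Finset.sum_boole]

/-- The indicator of `[-π, π]`. -/
noncomputable def cutoff (t : ℝ) : ℂ := Set.indicator (Set.Icc (-Real.pi) Real.pi) 1 t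

lemma measurable_cutoff : Measurable cutoff :=
  measurable_one.indicator measurableSet_Icc

lemma cutoff_eq_one {t : ℝ} (ht : |t| ≤ Real.pi) : cutoff t = 1 := by
  simp [cutoff, abs_le.1 ht]

lemma cutoff_eq_zero {t : ℝ} (ht : ¬ |t| ≤ Real.pi) : cutoff t = 0 := by
  rw [cutoff, Set.indicator_of_notMem]
  rwa [Set.mem_Icc, ← abs_le]

lemma integral_cutoff_mul_exp (d : ℤ) :
    ∫ t : ℝ, cutoff t * Complex.exp (((t * d : ℝ) : ℂ) * Complex.I)
      = if d = 0 then ((2 * Real.pi : ℝ) : ℂ) else 0 := by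
  have h1 : ∀ t : ℝ, cutoff t * Complex.exp (((t * d : ℝ) : ℂ) * Complex.I)
      = Set.indicator (Set.Icc (-Real.pi) Real.pi)
        (fun t : ℝ => Complex.exp ((d * Complex.I) * t)) t := by
    intro t
    by_cases ht : t ∈ Set.Icc (-Real.pi) Real.pi
    · simp only [cutoff, Set.indicator_of_mem ht, Pi.one_apply, one_mul]
      push_cast
      ring_nf
    · simp [cutoff, Set.indicator_of_notMem ht]
  simp only [h1]
  rw [integral_indicator measurableSet_Icc, integral_Icc_eq_integral_Ioc,
    ← intervalIntegral.integral_of_le (by linarith [Real.pi_pos])]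
  split_ifs with hd
  · simp [hd]
    ring
  · rw [integral_exp_mul_complex (by simp [hd])]
    have : Complex.exp (d * Complex.I * (Real.pi : ℝ))
        = Complex.exp (d * Complex.I * ((-Real.pi : ℝ) : ℂ)) := by
      rw [Complex.exp_eq_exp_iff_exists_int]
      exact ⟨d, by push_cast; ring⟩
    rw [this, sub_self, zero_div]

lemma integrable_cutoff_mul_exp (d : ℤ) :
    Integrable fun t : ℝ => cutoff t * Complex.exp (((t * d : ℝ) : ℂ) * Complex.I) := by
  have h : Integrable cutoff := by
    refine (integrable_indicator_iff measurableSet_Icc).2 ?_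
    exact (integrableOn_const (C := (1 : ℂ)) (by simp))
  refine h.mul_bdd (c := 1) (by fun_prop) (ae_of_all _ fun t => ?_)
  rw [Complex.norm_exp_ofReal_mul_I]

lemma sum_mul_zeroSumExt {k n : ℕ} (σ : Fin n → Fin (k + 1)) (X : Fin n → ℕ) (θ : Fin k → ℝ) :
    ∑ j, (X j : ℝ) * zeroSumExt θ (σ j)
      = ∑ i, θ i * (((blockSum σ X i.castSucc : ℤ) - (blockSum σ X (Fin.last k) : ℤ) : ℤ) : ℝ) := by
  rw [← Finset.sum_fiberwise Finset.univ σ]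
  have h : ∀ α, ∑ j with σ j = α, (X j : ℝ) * zeroSumExt θ (σ j)
      = blockSum σ X α * zeroSumExt θ α := by
    intro α
    rw [blockSum, Nat.cast_sum, Finset.sum_mul]
    refine Finset.sum_congr rfl fun j hj => ?_
    rw [(Finset.mem_filter.1 hj).2]
  simp only [h]
  rw [Fin.sum_univ_castSucc]
  simp only [zeroSumExt_castSucc, zeroSumExt_last]
  push_cast
  simp only [mul_sub, Finset.sum_sub_distrib, ← Finset.sum_mul]
  simp only [mul_comm]
  ring

lemma equalBlockSums_iff {k n : ℕ} (σ : Fin n → Fin (k + 1)) (X : Fin n → ℕ) :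
    EqualBlockSums σ X ↔ ∀ i : Fin k,
      (blockSum σ X i.castSucc : ℤ) - (blockSum σ X (Fin.last k) : ℤ) = 0 := by
  simp only [sub_eq_zero, Nat.cast_inj]
  refine ⟨fun h i => h _ _, fun h => ?_⟩
  have h' : ∀ α, blockSum σ X α = blockSum σ X (Fin.last k) :=
    fun α => Fin.lastCases rfl h α
  exact fun α β => (h' α).trans (h' β).symm

/-- Fourier inversion on the torus for the event that `σ` is balanced. -/
lemma balancedProb_mul_eq_integral {k n : ℕ} (M : ℕ) (σ : Fin n → Fin (k + 1)) :
    (balancedProb M σ : ℂ) * ((2 * Real.pi : ℝ) : ℂ) ^ k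
      = ∫ θ : Fin k → ℝ, (∏ i, cutoff (θ i)) * ∏ j, unifChar M (zeroSumExt θ (σ j)) := by
  classical
  have hexp : ∀ θ : Fin k → ℝ, (∏ i, cutoff (θ i)) * ∏ j, unifChar M (zeroSumExt θ (σ j))
      = (∑ X : Fin n → Fin M, ∏ i, (cutoff (θ i) * Complex.exp (((θ i *
          (((blockSum σ (fun j => (X j : ℕ) + 1) i.castSucc : ℤ)
            - (blockSum σ (fun j => (X j : ℕ) + 1) (Fin.last k) : ℤ) : ℤ) : ℝ) : ℝ) : ℂ)
            * Complex.I))) / (M : ℂ) ^ n := by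
    intro θ
    simp only [unifChar, Finset.prod_div_distrib, Finset.prod_const, Finset.card_univ,
      Fintype.card_fin, Finset.prod_univ_sum, Fintype.piFinset_univ]
    rw [← mul_div_assoc, Finset.mul_sum]
    congr 1
    refine Finset.sum_congr rfl fun X _ => ?_
    rw [Finset.prod_mul_distrib, ← Complex.exp_sum, ← Complex.exp_sum, ← Finset.sum_mul,
      ← Finset.sum_mul, ← Complex.ofReal_sum, ← Complex.ofReal_sum, ← sum_mul_zeroSumExt]
    push_cast
    rfl
  have hintegral : ∀ d : Fin k → ℤ, ∫ θ : Fin k → ℝ,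
      ∏ i, (cutoff (θ i) * Complex.exp (((θ i * d i : ℝ) : ℂ) * Complex.I))
      = if ∀ i, d i = 0 then ((2 * Real.pi : ℝ) : ℂ) ^ k else 0 := by
    intro d
    rw [integral_fintype_prod_volume_eq_prod (𝕜 := ℂ) (ι := Fin k) (E := fun _ => ℝ)
      (fun i t => cutoff t * Complex.exp (((t * d i : ℝ) : ℂ) * Complex.I))]
    simp only [integral_cutoff_mul_exp, Finset.prod_ite_zero, Finset.mem_univ, true_imp_iff,
      Finset.prod_const, Finset.card_univ, Fintype.card_fin]
  simp only [hexp]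
  rw [integral_div, integral_finsetSum]
  · rw [Finset.sum_congr rfl fun X _ => hintegral _, balancedProb]
    simp only [← equalBlockSums_iff]
    rw [← Finset.sum_filter, Finset.sum_const, nsmul_eq_mul]
    push_cast
    ring
  · intro X _
    exact Integrable.fintype_prod (fun i => integrable_cutoff_mul_exp _)

lemma card_equalBlockSums_mul_le {k n : ℕ} (M : ℕ) (σ : Fin n → Fin (k + 1))
    (hσ : Function.Surjective σ) [DecidablePred fun X : Fin n → Fin M =>
      EqualBlockSums σ fun j => (X j : ℕ) + 1] :
    (Finset.univ.filter fun X : Fin n → Fin M =>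
      EqualBlockSums σ fun j => (X j : ℕ) + 1).card * M ^ k ≤ M ^ n := by
  classical
  choose r hr using fun i : Fin k => hσ i.castSucc
  have hrinj : Function.Injective r := fun i i' h =>
    Fin.castSucc_injective k (by rw [← hr i, ← hr i', h])
  set R : Finset (Fin n) := Finset.univ.image r with hR
  have hRcard : R.card = k := by
    rw [hR, Finset.card_image_of_injective _ hrinj, Finset.card_univ, Fintype.card_fin]
  have hcompl : Fintype.card {j // j ∉ R} + k = n := by
    rw [Fintype.card_subtype_compl, Fintype.card_coe, hRcard, Fintype.card_fin]
    have : R.card ≤ n := by simpa using R.card_le_univ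
    omega
  have hle : (Finset.univ.filter fun X : Fin n → Fin M =>
      EqualBlockSums σ fun j => (X j : ℕ) + 1).card
      ≤ (Finset.univ : Finset ({j // j ∉ R} → Fin M)).card := by
    refine Finset.card_le_card_of_injOn (fun X j => X j.1) (fun _ _ => Finset.mem_univ _) ?_
    intro X hX Y hY hXY
    have hX' : EqualBlockSums σ fun j => (X j : ℕ) + 1 := (Finset.mem_filter.1 hX).2
    have hY' : EqualBlockSums σ fun j => (Y j : ℕ) + 1 := (Finset.mem_filter.1 hY).2
    have hoff : ∀ j, j ∉ R → X j = Y j := fun j hj => congrFun hXY ⟨j, hj⟩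
    have hmemR : ∀ j, j ∈ R → ∃ i, r i = j := by
      intro j hj
      simpa [hR] using hj
    have hlast : blockSum σ (fun j => (X j : ℕ) + 1) (Fin.last k)
        = blockSum σ (fun j => (Y j : ℕ) + 1) (Fin.last k) := by
      refine Finset.sum_congr rfl fun j hj => ?_
      suffices j ∉ R by simp only [hoff j this]
      intro hjR
      obtain ⟨i, rfl⟩ := hmemR j hjR
      have := (Finset.mem_filter.1 hj).2
      rw [hr i] at this
      exact (Fin.castSucc_lt_last i).ne this
    have hrep : ∀ i, X (r i) = Y (r i) := by
      intro i
      have hi : blockSum σ (fun j => (X j : ℕ) + 1) i.castSucc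
          = blockSum σ (fun j => (Y j : ℕ) + 1) i.castSucc :=
        (hX' _ _).trans (hlast.trans (hY' _ _))
      have hmem : r i ∈ Finset.univ.filter fun j => σ j = i.castSucc := by simp [hr i]
      rw [blockSum, blockSum, ← Finset.add_sum_erase _ _ hmem, ← Finset.add_sum_erase _ _ hmem]
        at hi
      have hrest : ∑ j ∈ (Finset.univ.filter fun j => σ j = i.castSucc).erase (r i),
          ((X j : ℕ) + 1) = ∑ j ∈ (Finset.univ.filter fun j => σ j = i.castSucc).erase (r i),
          ((Y j : ℕ) + 1) := by
        refine Finset.sum_congr rfl fun j hj => ?_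
        rw [hoff j fun hjR => ?_]
        obtain ⟨i', rfl⟩ := hmemR j hjR
        rw [Finset.mem_erase, Finset.mem_filter, hr i'] at hj
        exact hj.1 (congrArg r (Fin.castSucc_injective k hj.2.2))
      rw [hrest] at hi
      exact Fin.ext (by omega)
    funext j
    by_cases hj : j ∈ R
    · obtain ⟨i, rfl⟩ := hmemR j hj
      exact hrep i
    · exact hoff j hj
  calc _ ≤ (Finset.univ : Finset ({j // j ∉ R} → Fin M)).card * M ^ k := by gcongr
    _ = M ^ n := by
      rw [Finset.card_univ, Fintype.card_fun, Fintype.card_fin, ← pow_add, hcompl]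

lemma balancedProb_le {k n : ℕ} (M : ℕ) (hM : 1 ≤ M) (σ : Fin n → Fin (k + 1))
    (hσ : Function.Surjective σ) : balancedProb M σ ≤ ((M : ℝ) ^ k)⁻¹ := by
  classical
  have hMpos : (0 : ℝ) < M := by exact_mod_cast hM
  rw [balancedProb, ← one_div, div_le_div_iff₀ (by positivity) (by positivity), one_mul]
  exact_mod_cast card_equalBlockSums_mul_le M σ hσ

/-- The size of block `α`. -/
def blockCard {ν n : ℕ} (σ : Fin n → Fin ν) (α : Fin ν) : ℕ :=
  (Finset.univ.filter fun j => σ j = α).card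

lemma sum_half_pow_blockCard (ν n : ℕ) (α : Fin ν) :
    ∑ σ : Fin n → Fin ν, (1 / 2 : ℝ) ^ blockCard σ α = ((ν : ℝ) - 1 / 2) ^ n := by
  have h : ∀ σ : Fin n → Fin ν, (1 / 2 : ℝ) ^ blockCard σ α
      = ∏ j, if σ j = α then (1 / 2 : ℝ) else 1 := by
    intro σ
    rw [Finset.prod_ite, Finset.prod_const, Finset.prod_const_one, mul_one, blockCard]
  have hs : ∑ β : Fin ν, (if β = α then (1 / 2 : ℝ) else 1) = (ν : ℝ) - 1 / 2 := by
    have : ∀ β : Fin ν, (if β = α then (1 / 2 : ℝ) else 1) = 1 - if β = α then (1 / 2 : ℝ) else 0 := by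
      intro β
      split_ifs <;> norm_num
    simp only [this, Finset.sum_sub_distrib, Finset.sum_ite_eq', Finset.mem_univ, if_true]
    simp
  simp only [h]
  rw [← Fintype.piFinset_univ, ← Finset.prod_univ_sum (fun _ : Fin n => Finset.univ)
    (fun _ β => if β = α then (1 / 2 : ℝ) else 1)]
  simp only [hs, Finset.prod_const, Finset.card_univ, Fintype.card_fin]

lemma card_small_block_le (ν n m : ℕ) :
    ((Finset.univ.filter fun σ : Fin n → Fin ν => ∃ α, blockCard σ α < m).card : ℝ)
      ≤ ν * (2 ^ m * ((ν : ℝ) - 1 / 2) ^ n) := by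
  have h1 : ∀ α : Fin ν,
      ((Finset.univ.filter fun σ : Fin n → Fin ν => blockCard σ α < m).card : ℝ)
        ≤ 2 ^ m * ((ν : ℝ) - 1 / 2) ^ n := by
    intro α
    rw [← sum_half_pow_blockCard ν n α, Finset.mul_sum, ← Finset.sum_boole]
    refine Finset.sum_le_sum fun σ _ => ?_
    split_ifs with h
    · have h2 : (1 / 2 : ℝ) ^ m ≤ (1 / 2 : ℝ) ^ blockCard σ α :=
        pow_le_pow_of_le_one (by norm_num) (by norm_num) h.le
      calc (1 : ℝ) = 2 ^ m * (1 / 2) ^ m := by rw [← mul_pow]; norm_num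
        _ ≤ _ := by gcongr
    · positivity
  have h2 : (Finset.univ.filter fun σ : Fin n → Fin ν => ∃ α, blockCard σ α < m)
      ⊆ Finset.univ.biUnion fun α => Finset.univ.filter fun σ : Fin n → Fin ν =>
        blockCard σ α < m := by
    intro σ hσ
    simpa using hσ
  calc ((Finset.univ.filter fun σ : Fin n → Fin ν => ∃ α, blockCard σ α < m).card : ℝ)
      ≤ ∑ α : Fin ν, ((Finset.univ.filter fun σ : Fin n → Fin ν =>
          blockCard σ α < m).card : ℝ) := by
        exact_mod_cast (Finset.card_le_card h2).trans Finset.card_biUnion_le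
    _ ≤ ∑ _α : Fin ν, 2 ^ m * ((ν : ℝ) - 1 / 2) ^ n := Finset.sum_le_sum fun α _ => h1 α
    _ = _ := by simp

/-- Assignments with a block of size below a fixed small fraction of `n` are exponentially rare. -/
lemma exists_card_small_block_le (ν : ℕ) (hν : 1 ≤ ν) :
    ∃ K : ℕ, 1 ≤ K ∧ ∃ ρ : ℝ, 0 < ρ ∧ ρ < 1 ∧ ∀ n : ℕ,
      ((Finset.univ.filter fun σ : Fin n → Fin ν =>
        ∃ α, blockCard σ α < 2 * (n / (4 * K))).card : ℝ) / (ν : ℝ) ^ n ≤ ν * ρ ^ n := by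
  have hν1 : (1 : ℝ) ≤ ν := by exact_mod_cast hν
  set r : ℝ := 1 - 1 / (2 * ν) with hr
  have hr1 : r < 1 := by
    rw [hr]
    linarith [show 0 < 1 / (2 * (ν : ℝ)) by positivity]
  have hr0 : 0 < r := by
    rw [hr, sub_pos, div_lt_one (by positivity)]
    linarith
  obtain ⟨K, hK⟩ := exists_pow_lt_of_lt_one (show (0 : ℝ) < 1 / 2 by norm_num) hr1
  have hK1 : 1 ≤ K := by
    rcases Nat.eq_zero_or_pos K with rfl | h
    · norm_num at hK
    · exact h
  have hρ1 : √r < 1 := by rw [Real.sqrt_lt' one_pos]; simpa using hr1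
  refine ⟨K, hK1, √r, Real.sqrt_pos.2 hr0, hρ1, fun n => ?_⟩
  set m := 2 * (n / (4 * K)) with hm
  have hKm : 2 * (K * m) ≤ n := by
    have := Nat.mul_div_le n (4 * K)
    calc 2 * (K * m) = 4 * K * (n / (4 * K)) := by rw [hm]; ring
      _ ≤ n := this
  rw [div_le_iff₀ (by positivity)]
  refine (card_small_block_le ν n m).trans ?_
  have hνr : (ν : ℝ) - 1 / 2 = r * ν := by
    rw [hr]
    field_simp
  have hpow : 2 ^ m * r ^ n ≤ √r ^ n := by
    calc 2 ^ m * r ^ n = (2 * r ^ K) ^ m * r ^ (n - K * m) := by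
          rw [mul_pow, ← pow_mul, mul_assoc, ← pow_add]
          congr 2
          omega
      _ ≤ 1 * r ^ (n - K * m) := by
          gcongr
          exact pow_le_one₀ (by positivity) (by linarith)
      _ = √r ^ (2 * (n - K * m)) := by rw [one_mul, pow_mul, Real.sq_sqrt hr0.le]
      _ ≤ √r ^ n := pow_le_pow_of_le_one (Real.sqrt_nonneg _) hρ1.le (by omega)
  rw [hνr, mul_pow]
  calc (ν : ℝ) * (2 ^ m * (r ^ n * ν ^ n)) = ν * (2 ^ m * r ^ n) * ν ^ n := by ring
    _ ≤ ν * √r ^ n * ν ^ n := by gcongr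

lemma integral_exp_neg_sum_zeroSumExt_sq (k : ℕ) (b : ℝ) :
    ∫ x : Fin k → ℝ, Real.exp (-b * ∑ α, zeroSumExt x α ^ 2)
      = √(Real.pi / b) ^ k / √(k + 1) := by
  set s : ℝ := √(k + 1) with hs
  have hs0 : 0 < s := Real.sqrt_pos.2 (by positivity)
  have hss : s ^ 2 = k + 1 := Real.sq_sqrt (by positivity)
  set β : ℝ := 1 / (s + 1) with hβ
  have hkβ : 1 + k * β = s := by
    have : (k : ℝ) = s ^ 2 - 1 := by linarith
    rw [this, hβ]
    field_simp
    ring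
  set A : Matrix (Fin k) (Fin k) ℝ := (1 : Matrix (Fin k) (Fin k) ℝ)
    + Matrix.replicateCol Unit (fun _ : Fin k => β)
    * Matrix.replicateRow Unit (fun _ : Fin k => (1 : ℝ)) with hA
  have hdet : A.det = s := by
    rw [hA, Matrix.det_one_add_replicateCol_mul_replicateRow]
    simp [dotProduct, hkβ]
  have hAx : ∀ x i, Matrix.toLin' A x i = x i + β * ∑ j, x j := by
    intro x i
    simp [hA, Matrix.mulVec, dotProduct, Matrix.mul_apply, Finset.mul_sum]
  have hquad : ∀ x : Fin k → ℝ, ∑ α, zeroSumExt x α ^ 2 = ∑ i, Matrix.toLin' A x i ^ 2 := by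
    intro x
    simp only [hAx, Fin.sum_univ_castSucc, zeroSumExt_castSucc, zeroSumExt_last]
    set S := ∑ j, x j with hS
    have h1 : ∑ i, (x i + β * S) ^ 2 = ∑ i, x i ^ 2 + 2 * β * S * S + k * (β * S) ^ 2 := by
      simp only [add_sq, Finset.sum_add_distrib, ← Finset.sum_mul, ← Finset.mul_sum, ← hS]
      simp
      ring
    rw [h1]
    have h2 : β * (s + 1) = 1 := by rw [hβ]; field_simp
    have h3 : 2 * β + k * β ^ 2 = 1 := by rw [← h2, ← hkβ]; ring
    linear_combination (-S ^ 2) * h3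
  have hmap := Real.map_matrix_volume_pi_eq_smul_volume_pi (M := A) (by rw [hdet]; exact hs0.ne')
  have hcont : Continuous fun y : Fin k → ℝ => Real.exp (-b * ∑ i, y i ^ 2) := by fun_prop
  have hchange := integral_map (μ := volume) (φ := Matrix.toLin' A)
    (by exact (LinearMap.continuous_of_finiteDimensional _).aemeasurable)
    (hcont.aestronglyMeasurable)
  simp only [hquad]
  rw [← hchange, hmap, integral_smul_measure, hdet]
  have hprod : ∫ y : Fin k → ℝ, Real.exp (-b * ∑ i, y i ^ 2) = √(Real.pi / b) ^ k := by
    simp only [Finset.mul_sum, Real.exp_sum]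
    rw [integral_fintype_prod_volume_eq_prod (𝕜 := ℝ) (ι := Fin k) (E := fun _ => ℝ)
      (fun _ t => Real.exp (-b * t ^ 2))]
    simp only [integral_gaussian, Finset.prod_const, Finset.card_univ, Fintype.card_fin]
  rw [hprod, ENNReal.toReal_ofReal (abs_nonneg _), abs_of_pos (inv_pos.2 hs0), smul_eq_mul]
  ring

/-- The assignments all of whose blocks have at least `m` elements. -/
def typicalAssignments (ν n m : ℕ) : Finset (Fin n → Fin ν) :=
  Finset.univ.filter fun σ => ∀ α, m ≤ blockCard σ α

lemma compl_typicalAssignments (ν n m : ℕ) : (typicalAssignments ν n m)ᶜ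
    = Finset.univ.filter fun σ : Fin n → Fin ν => ∃ α, blockCard σ α < m := by
  ext σ
  simp [typicalAssignments]

/-- The contribution of the assignments in `W` to the Fourier integrand. -/
noncomputable def fourierIntegrand {k n : ℕ} (M : ℕ) (W : Finset (Fin n → Fin (k + 1)))
    (θ : Fin k → ℝ) : ℂ :=
  (∏ i, cutoff (θ i)) * ((∑ σ ∈ W, ∏ j, unifChar M (zeroSumExt θ (σ j))) / ((k : ℂ) + 1) ^ n)

lemma norm_prod_unifChar_le_one {n ν : ℕ} (M : ℕ) (σ : Fin n → Fin ν) (θ : Fin ν → ℝ) :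
    ‖∏ j, unifChar M (θ (σ j))‖ ≤ 1 := by
  rw [norm_prod]
  exact Finset.prod_le_one (fun _ _ => norm_nonneg _) fun _ _ => norm_unifChar_le_one _ _

lemma norm_prod_unifChar_le {k n h : ℕ} (M : ℕ) (σ : Fin n → Fin (k + 1))
    (hσ : ∀ α, h ≤ blockCard σ α) (θ : Fin k → ℝ) :
    ‖∏ j, unifChar M (zeroSumExt θ (σ j))‖ ≤ ∏ i, ‖unifChar M (θ i)‖ ^ h := by
  rw [norm_prod, ← Finset.prod_fiberwise Finset.univ σ]
  have hfib : ∀ α, ∏ j with σ j = α, ‖unifChar M (zeroSumExt θ (σ j))‖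
      = ‖unifChar M (zeroSumExt θ α)‖ ^ blockCard σ α := by
    intro α
    rw [blockCard, ← Finset.prod_const]
    refine Finset.prod_congr rfl fun j hj => ?_
    rw [(Finset.mem_filter.1 hj).2]
  simp only [hfib]
  rw [Fin.prod_univ_castSucc]
  refine (mul_le_of_le_one_right (by positivity)
    (pow_le_one₀ (norm_nonneg _) (norm_unifChar_le_one _ _))).trans ?_
  refine Finset.prod_le_prod (fun _ _ => by positivity) fun i _ => ?_
  rw [zeroSumExt_castSucc]
  exact pow_le_pow_of_le_one (norm_nonneg _) (norm_unifChar_le_one _ _) (hσ _)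

lemma norm_cutoff_mul_pow_le {K n M : ℕ} (hK : 1 ≤ K) (hn : 4 * K ≤ n) (hM : 2 ≤ M) (x : ℝ) :
    ‖cutoff ((M * √n)⁻¹ * x)‖ * ‖unifChar M ((M * √n)⁻¹ * x)‖ ^ (2 * (n / (4 * K)))
      ≤ (1 + x ^ 2 / (1152 * K))⁻¹ := by
  have hKpos : (0 : ℝ) < K := by exact_mod_cast hK
  have hnpos : (0 : ℝ) < n := by exact_mod_cast (by omega : 0 < n)
  have hMpos : (0 : ℝ) < M := by exact_mod_cast (by omega : 0 < M)
  by_cases ht : |(M * √n)⁻¹ * x| ≤ Real.pi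
  · rw [cutoff_eq_one ht, norm_one, one_mul]
    refine (norm_unifChar_pow_le M hM ht _).trans ?_
    have hh : (n : ℝ) ≤ 8 * K * (n / (4 * K) : ℕ) := by
      have h1 : 1 ≤ n / (4 * K) := (Nat.one_le_div_iff (by omega)).2 hn
      have h2 : n < 4 * K * (n / (4 * K) + 1) := Nat.lt_mul_div_succ n (by omega)
      have h3 : n ≤ 8 * K * (n / (4 * K)) := by nlinarith
      exact_mod_cast h3
    have hsq : (M * ((M * √n)⁻¹ * x)) ^ 2 = x ^ 2 / n := by
      have : (M : ℝ) * ((M * √n)⁻¹ * x) = x / √n := by field_simp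
      rw [this, div_pow, Real.sq_sqrt hnpos.le]
    rw [hsq]
    gcongr
    rw [div_le_iff₀ (by positivity)]
    have hkey : 1 ≤ (n / (4 * K) : ℕ) * (8 * K) / (n : ℝ) := by
      rw [le_div_iff₀ hnpos]
      linarith
    calc x ^ 2 = x ^ 2 * 1 := (mul_one _).symm
      _ ≤ x ^ 2 * ((n / (4 * K) : ℕ) * (8 * K) / (n : ℝ)) := by gcongr
      _ = _ := by ring
  · rw [cutoff_eq_zero ht]
    simp only [norm_zero, zero_mul]
    positivity

lemma norm_fourierIntegrand_le {k K n M : ℕ} (hK : 1 ≤ K) (hn : 4 * K ≤ n) (hM : 2 ≤ M)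
    (x : Fin k → ℝ) :
    ‖fourierIntegrand M (typicalAssignments (k + 1) n (2 * (n / (4 * K)))) ((M * √n)⁻¹ • x)‖
      ≤ ∏ i, (1 + x i ^ 2 / (1152 * K))⁻¹ := by
  set W := typicalAssignments (k + 1) n (2 * (n / (4 * K))) with hW
  set θ : Fin k → ℝ := (M * √n)⁻¹ • x with hθ
  have hsum : ‖(∑ σ ∈ W, ∏ j, unifChar M (zeroSumExt θ (σ j))) / ((k : ℂ) + 1) ^ n‖
      ≤ ∏ i, ‖unifChar M (θ i)‖ ^ (2 * (n / (4 * K))) := by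
    have hden : ‖((k : ℂ) + 1) ^ n‖ = ((k : ℝ) + 1) ^ n := by
      rw [norm_pow]
      congr 1
      exact_mod_cast Complex.norm_natCast (k + 1)
    rw [norm_div, hden, div_le_iff₀ (by positivity)]
    refine (norm_sum_le_of_le W fun σ hσ =>
      norm_prod_unifChar_le M σ (Finset.mem_filter.1 hσ).2 θ).trans ?_
    rw [Finset.sum_const, nsmul_eq_mul, mul_comm]
    gcongr
    have := W.card_le_univ
    rw [Fintype.card_fun, Fintype.card_fin, Fintype.card_fin] at this
    exact_mod_cast this
  rw [fourierIntegrand, norm_mul, norm_prod]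
  calc _ ≤ (∏ i, ‖cutoff (θ i)‖) * ∏ i, ‖unifChar M (θ i)‖ ^ (2 * (n / (4 * K))) := by gcongr
    _ ≤ _ := by
      rw [← Finset.prod_mul_distrib]
      exact Finset.prod_le_prod (fun _ _ => by positivity)
        fun i _ => norm_cutoff_mul_pow_le hK hn hM (x i)

lemma integrable_prod_inv_one_add_sq_div {k : ℕ} {c : ℝ} (hc : 0 < c) :
    Integrable fun x : Fin k → ℝ => ∏ i, (1 + x i ^ 2 / c)⁻¹ := by
  refine Integrable.fintype_prod (f := fun _ t => (1 + t ^ 2 / c)⁻¹) fun i => ?_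
  have h := integrable_inv_one_add_sq.comp_mul_left' (R := (√c)⁻¹)
    (inv_ne_zero (Real.sqrt_pos.2 hc).ne')
  refine h.congr (ae_of_all _ fun t => ?_)
  simp only [mul_pow, inv_pow, Real.sq_sqrt hc.le]
  rw [div_eq_inv_mul]

lemma measurable_fourierIntegrand {k n : ℕ} (M : ℕ) (W : Finset (Fin n → Fin (k + 1))) :
    Measurable (fourierIntegrand M W) := by
  have h1 : ∀ α, Measurable fun θ : Fin k → ℝ => unifChar M (zeroSumExt θ α) := fun α =>
    ((continuous_unifChar M).comp (continuous_zeroSumExt α)).measurable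
  have h2 : ∀ i, Measurable fun θ : Fin k → ℝ => cutoff (θ i) := fun i =>
    measurable_cutoff.comp (measurable_pi_apply i)
  unfold fourierIntegrand
  fun_prop

lemma integrable_cutoff_mul_prod {k n : ℕ} (M : ℕ) (σ : Fin n → Fin (k + 1)) :
    Integrable fun θ : Fin k → ℝ =>
      (∏ i, cutoff (θ i)) * ∏ j, unifChar M (zeroSumExt θ (σ j)) := by
  have h : Integrable fun θ : Fin k → ℝ => ∏ i, cutoff (θ i) := by
    refine Integrable.fintype_prod (f := fun _ t => cutoff t) fun i => ?_
    simpa using integrable_cutoff_mul_exp 0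
  refine h.mul_bdd (c := 1) ?_ (ae_of_all _ fun θ => norm_prod_unifChar_le_one M σ _)
  refine Continuous.aestronglyMeasurable (continuous_finsetProd _ fun j _ => ?_)
  exact (continuous_unifChar M).comp (continuous_zeroSumExt _)

lemma integral_fourierIntegrand {k n : ℕ} (M : ℕ) (W : Finset (Fin n → Fin (k + 1))) :
    ∫ θ, fourierIntegrand M W θ
      = (((∑ σ ∈ W, balancedProb M σ) / ((k : ℝ) + 1) ^ n * (2 * Real.pi) ^ k : ℝ) : ℂ) := by
  have h : ∀ θ : Fin k → ℝ, fourierIntegrand M W θ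
      = (∑ σ ∈ W, (∏ i, cutoff (θ i)) * ∏ j, unifChar M (zeroSumExt θ (σ j)))
        / ((k : ℂ) + 1) ^ n := by
    intro θ
    rw [fourierIntegrand, ← Finset.mul_sum, mul_div_assoc]
  simp only [h]
  rw [integral_div, integral_finsetSum _ fun σ _ => integrable_cutoff_mul_prod M σ]
  simp only [← balancedProb_mul_eq_integral]
  rw [← Finset.sum_mul]
  push_cast
  ring

lemma integral_fourierIntegrand_smul {k n : ℕ} {M : ℕ} (hM : 1 ≤ M) (hn : 1 ≤ n)
    (W : Finset (Fin n → Fin (k + 1))) :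
    ∫ x : Fin k → ℝ, fourierIntegrand M W ((M * √n)⁻¹ • x)
      = (((∑ σ ∈ W, balancedProb M σ) * (M * √n) ^ k / ((k : ℝ) + 1) ^ n
        * (2 * Real.pi) ^ k : ℝ) : ℂ) := by
  have hMpos : (0 : ℝ) < M := by exact_mod_cast hM
  have hnpos : (0 : ℝ) < n := by exact_mod_cast hn
  have hpos : 0 < M * √(n : ℝ) := mul_pos hMpos (Real.sqrt_pos.2 hnpos)
  rw [Measure.integral_comp_smul, integral_fourierIntegrand, Module.finrank_fintype_fun_eq_card,
    Fintype.card_fin, inv_pow, inv_inv, abs_of_pos (by positivity), Complex.real_smul]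
  push_cast
  ring

lemma sum_prod_comp_eq_pow {R : Type*} [CommSemiring R] (ν n : ℕ) (f : Fin ν → R) :
    ∑ σ : Fin n → Fin ν, ∏ j, f (σ j) = (∑ α, f α) ^ n := by
  rw [← Fintype.piFinset_univ, ← Finset.prod_univ_sum (fun _ : Fin n => Finset.univ)
    (fun _ α => f α), Finset.prod_const, Finset.card_univ, Fintype.card_fin]

lemma tendsto_mean_unifChar_pow {k : ℕ} (M : ℕ → ℕ) (hM1 : ∀ n, 1 ≤ M n)
    (hM : Tendsto M atTop atTop) (x : Fin k → ℝ) :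
    Tendsto (fun n : ℕ => ((∑ α, unifChar (M n) (zeroSumExt ((M n * √n)⁻¹ • x) α))
      / ((k : ℂ) + 1)) ^ n) atTop
      (nhds (Real.exp (-(1 / (6 * ((k : ℝ) + 1))) * ∑ α, zeroSumExt x α ^ 2) : ℂ)) := by
  have hk : (k : ℂ) + 1 ≠ 0 := by exact_mod_cast (Nat.succ_ne_zero k)
  have hlim := (tendsto_finsetSum Finset.univ fun α _ =>
    tendsto_mul_unifChar_sub M hM1 hM (zeroSumExt x α)).div_const ((k : ℂ) + 1)
  have hval : (∑ α, ((-(zeroSumExt x α ^ 2 / 6) : ℝ) : ℂ)) / ((k : ℂ) + 1)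
      = ((-(1 / (6 * ((k : ℝ) + 1))) * ∑ α, zeroSumExt x α ^ 2 : ℝ) : ℂ) := by
    rw [← Complex.ofReal_sum, Finset.sum_neg_distrib, ← Finset.sum_div]
    push_cast
    field_simp
  rw [hval] at hlim
  rw [Complex.ofReal_exp]
  have hg : ∀ n : ℕ, (∑ α, (n : ℂ) * (unifChar (M n) ((M n * √n)⁻¹ * zeroSumExt x α) - 1
      - (((M n + 1) / 2 * ((M n * √n)⁻¹ * zeroSumExt x α) : ℝ) : ℂ) * Complex.I))
        / ((k : ℂ) + 1)
      = n * ((∑ α, unifChar (M n) (zeroSumExt ((M n * √n)⁻¹ • x) α)) / ((k : ℂ) + 1) - 1) := by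
    intro n
    have hdrift : ∑ α, (((M n + 1) / 2 * ((M n * √n)⁻¹ * zeroSumExt x α) : ℝ) : ℂ) = 0 := by
      rw [← Complex.ofReal_sum, ← Finset.mul_sum, ← Finset.mul_sum, sum_zeroSumExt]
      simp
    rw [← Finset.mul_sum, Finset.sum_sub_distrib, Finset.sum_sub_distrib, ← Finset.sum_mul, hdrift]
    simp only [zeroSumExt_smul, Finset.sum_const, Finset.card_univ, Fintype.card_fin, nsmul_eq_mul]
    push_cast
    field_simp
    ring
  refine (Complex.tendsto_one_add_pow_exp_of_tendsto (hlim.congr hg)).congr fun n => ?_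
  rw [add_sub_cancel]

lemma tendsto_mul_sqrt_inv (M : ℕ → ℕ) (hM : Tendsto M atTop atTop) :
    Tendsto (fun n : ℕ => ((M n : ℝ) * √n)⁻¹) atTop (nhds 0) :=
  tendsto_inv_atTop_zero.comp ((tendsto_natCast_atTop_atTop.comp hM).atTop_mul_atTop₀
    (Real.tendsto_sqrt_atTop.comp tendsto_natCast_atTop_atTop))

lemma tendsto_fourierIntegrand {k : ℕ} (M : ℕ → ℕ) (hM1 : ∀ n, 1 ≤ M n)
    (hM : Tendsto M atTop atTop) (W : ∀ n, Finset (Fin n → Fin (k + 1)))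
    (hW : Tendsto (fun n : ℕ => ((W n)ᶜ.card : ℝ) / ((k : ℝ) + 1) ^ n) atTop (nhds 0))
    (x : Fin k → ℝ) :
    Tendsto (fun n : ℕ => fourierIntegrand (M n) (W n) ((M n * √n)⁻¹ • x)) atTop
      (nhds (Real.exp (-(1 / (6 * ((k : ℝ) + 1))) * ∑ α, zeroSumExt x α ^ 2) : ℂ)) := by
  have hcut : Tendsto (fun n : ℕ => ∏ i, cutoff (((M n * √n)⁻¹ • x) i)) atTop (nhds 1) := by
    refine tendsto_const_nhds.congr' ?_
    have h : ∀ i, ∀ᶠ n : ℕ in atTop, |((M n : ℝ) * √n)⁻¹ * x i| < Real.pi := by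
      intro i
      have := ((tendsto_mul_sqrt_inv M hM).mul_const (x i)).abs
      rw [zero_mul, abs_zero] at this
      exact this.eventually_lt_const Real.pi_pos
    filter_upwards [eventually_all.2 h] with n hn
    exact (Finset.prod_eq_one fun i _ => cutoff_eq_one (hn i).le).symm
  have hden : ∀ n : ℕ, ‖((k : ℂ) + 1) ^ n‖ = ((k : ℝ) + 1) ^ n := by
    intro n
    rw [norm_pow]
    congr 1
    exact_mod_cast Complex.norm_natCast (k + 1)
  have hsmall : Tendsto (fun n : ℕ => (∑ σ ∈ (W n)ᶜ, ∏ j,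
      unifChar (M n) (zeroSumExt ((M n * √n)⁻¹ • x) (σ j))) / ((k : ℂ) + 1) ^ n) atTop
      (nhds 0) := by
    refine squeeze_zero_norm (fun n => ?_) hW
    rw [norm_div, hden]
    gcongr
    refine (norm_sum_le_of_le _ fun σ _ => norm_prod_unifChar_le_one (M n) σ _).trans ?_
    simp
  have h := hcut.mul ((tendsto_mean_unifChar_pow M hM1 hM x).sub hsmall)
  rw [one_mul, sub_zero] at h
  refine h.congr fun n => ?_
  rw [fourierIntegrand, div_pow, ← sum_prod_comp_eq_pow, ← sub_div,
    ← Finset.sum_add_sum_compl (W n), add_sub_cancel_right]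

lemma surjective_of_mem_typicalAssignments {ν n m : ℕ} (hm : 1 ≤ m) {σ : Fin n → Fin ν}
    (hσ : σ ∈ typicalAssignments ν n m) : Function.Surjective σ := by
  intro α
  have h : 0 < blockCard σ α := lt_of_lt_of_le hm ((Finset.mem_filter.1 hσ).2 α)
  obtain ⟨j, hj⟩ := Finset.card_pos.1 h
  exact ⟨j, (Finset.mem_filter.1 hj).2⟩

lemma abs_EZ_sub_sum_typical_le {k n m M : ℕ} (hM : 1 ≤ M) (hm : 1 ≤ m) :
    |EZ (k + 1) n M - ∑ σ ∈ typicalAssignments (k + 1) n m, balancedProb M σ|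
      ≤ ((typicalAssignments (k + 1) n m)ᶜ.card : ℝ) * ((M : ℝ) ^ k)⁻¹ := by
  classical
  set W := typicalAssignments (k + 1) n m with hW
  have hsub : W ⊆ Finset.univ.filter fun σ : Fin n → Fin (k + 1) => Function.Surjective σ :=
    fun σ hσ => Finset.mem_filter.2
      ⟨Finset.mem_univ _, surjective_of_mem_typicalAssignments hm hσ⟩
  have hMpos : (0 : ℝ) < M := by exact_mod_cast hM
  rw [EZ_eq_sum_balancedProb, ← Finset.sum_sdiff hsub, add_sub_cancel_right,
    abs_of_nonneg (Finset.sum_nonneg fun σ _ => balancedProb_nonneg M σ)]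
  refine (Finset.sum_le_card_nsmul _ _ ((M : ℝ) ^ k)⁻¹ fun σ hσ => ?_).trans ?_
  · exact balancedProb_le M hM σ (Finset.mem_filter.1 (Finset.mem_sdiff.1 hσ).1).2
  · rw [nsmul_eq_mul]
    gcongr
    intro σ hσ
    exact Finset.mem_compl.2 (Finset.mem_sdiff.1 hσ).2

/-- The local limit theorem for the expected number of perfect partitions. -/
lemma tendsto_EZ_mul_scale (k : ℕ) (M : ℕ → ℕ) (hM1 : ∀ n, 1 ≤ M n)
    (hM : Tendsto M atTop atTop) :
    Tendsto (fun n : ℕ => EZ (k + 1) n (M n) * (M n * √n) ^ k / ((k : ℝ) + 1) ^ n) atTop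
      (nhds ((√(Real.pi / (1 / (6 * ((k : ℝ) + 1)))) ^ k / √(k + 1)) / (2 * Real.pi) ^ k)) := by
  obtain ⟨K, hK, ρ, hρ0, hρ1, hρ⟩ := exists_card_small_block_le (k + 1) (by omega)
  set W : ∀ n, Finset (Fin n → Fin (k + 1)) := fun n =>
    typicalAssignments (k + 1) n (2 * (n / (4 * K))) with hW
  have hWcard : ∀ n : ℕ, ((W n)ᶜ.card : ℝ) / ((k : ℝ) + 1) ^ n ≤ ((k : ℝ) + 1) * ρ ^ n := by
    intro n
    have := hρ n
    rw [← compl_typicalAssignments] at this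
    exact_mod_cast this
  have hWzero : Tendsto (fun n : ℕ => ((W n)ᶜ.card : ℝ) / ((k : ℝ) + 1) ^ n) atTop (nhds 0) := by
    refine squeeze_zero (fun n => by positivity) hWcard ?_
    simpa using (tendsto_pow_atTop_nhds_zero_of_lt_one hρ0.le hρ1).const_mul ((k : ℝ) + 1)
  have hintegral : Tendsto (fun n : ℕ =>
      ∫ x : Fin k → ℝ, fourierIntegrand (M n) (W n) ((M n * √n)⁻¹ • x)) atTop
      (nhds (∫ x : Fin k → ℝ,
        (Real.exp (-(1 / (6 * ((k : ℝ) + 1))) * ∑ α, zeroSumExt x α ^ 2) : ℂ))) := by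
    refine tendsto_integral_filter_of_dominated_convergence
      (fun x => ∏ i, (1 + x i ^ 2 / (1152 * K))⁻¹) ?_ ?_ ?_ ?_
    · exact Eventually.of_forall fun n => ((measurable_fourierIntegrand (M n) (W n)).comp
        (measurable_const_smul _)).aestronglyMeasurable
    · filter_upwards [eventually_ge_atTop (4 * K), hM.eventually_ge_atTop 2] with n hn hMn
      exact ae_of_all _ fun x => norm_fourierIntegrand_le hK hn hMn x
    · have : (0 : ℝ) < K := by exact_mod_cast hK
      exact integrable_prod_inv_one_add_sq_div (by positivity)
    · exact ae_of_all _ fun x => tendsto_fourierIntegrand M hM1 hM W hWzero x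
  rw [integral_complex_ofReal, integral_exp_neg_sum_zeroSumExt_sq] at hintegral
  have htyp : Tendsto (fun n : ℕ => (∑ σ ∈ W n, balancedProb (M n) σ) * (M n * √n) ^ k
      / ((k : ℝ) + 1) ^ n) atTop
      (nhds ((√(Real.pi / (1 / (6 * ((k : ℝ) + 1)))) ^ k / √(k + 1)) / (2 * Real.pi) ^ k)) := by
    have hre := (Complex.continuous_re.tendsto _).comp hintegral
    rw [Complex.ofReal_re] at hre
    refine (hre.div_const ((2 * Real.pi) ^ k)).congr' ?_
    filter_upwards [eventually_ge_atTop 1] with n hn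
    have hpi := Real.pi_pos
    rw [Function.comp_apply, integral_fourierIntegrand_smul (hM1 n) hn, Complex.ofReal_re]
    field_simp
  have herr : Tendsto (fun n : ℕ => ((k : ℝ) + 1) * ((n : ℝ) ^ k * ρ ^ n)) atTop (nhds 0) := by
    simpa using (tendsto_pow_const_mul_const_pow_of_abs_lt_one k
      (by rwa [abs_of_pos hρ0])).const_mul ((k : ℝ) + 1)
  refine tendsto_of_tendsto_of_dist htyp
    (squeeze_zero' (Eventually.of_forall fun _ => dist_nonneg) ?_ herr)
  filter_upwards [eventually_ge_atTop (4 * K)] with n hn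
  have hMpos : (0 : ℝ) < M n := by exact_mod_cast hM1 n
  have hn1 : (1 : ℝ) ≤ n := by exact_mod_cast (by omega : 1 ≤ n)
  have hm : 1 ≤ 2 * (n / (4 * K)) := by
    have : 1 ≤ n / (4 * K) := (Nat.one_le_div_iff (by omega)).2 hn
    omega
  rw [dist_comm, Real.dist_eq, ← sub_div, ← sub_mul, abs_div, abs_mul,
    abs_of_nonneg (a := ((M n : ℝ) * √n) ^ k) (by positivity),
    abs_of_nonneg (a := ((k : ℝ) + 1) ^ n) (by positivity)]
  calc _ ≤ ((W n)ᶜ.card : ℝ) * ((M n : ℝ) ^ k)⁻¹ * (M n * √n) ^ k / ((k : ℝ) + 1) ^ n := by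
        gcongr
        exact abs_EZ_sub_sum_typical_le (hM1 n) hm
    _ = √n ^ k * (((W n)ᶜ.card : ℝ) / ((k : ℝ) + 1) ^ n) := by
        rw [mul_pow]
        field_simp
    _ ≤ (n : ℝ) ^ k * (((k : ℝ) + 1) * ρ ^ n) := by
        gcongr
        · exact Real.sqrt_le_iff.2 ⟨by linarith, by nlinarith⟩
        · exact hWcard n
    _ = _ := by ring

lemma rpow_natCast_div_two {x : ℝ} (hx : 0 ≤ x) (k : ℕ) : x ^ ((k : ℝ) / 2) = √x ^ k := by
  rw [Real.sqrt_eq_rpow, ← Real.rpow_natCast, ← Real.rpow_mul hx]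
  congr 1
  ring

lemma rpow_sub_three_halves (k : ℕ) :
    ((k : ℝ) + 1) ^ ((k : ℝ) + 1 - 3 / 2) = ((k : ℝ) + 1) ^ k / √((k : ℝ) + 1) := by
  rw [Real.sqrt_eq_rpow, ← Real.rpow_natCast, ← Real.rpow_sub (by positivity)]
  congr 1
  ring

lemma gaussian_constant_eq (k : ℕ) :
    √(Real.pi / (1 / (6 * ((k : ℝ) + 1)))) ^ k / √((k : ℝ) + 1) / (2 * Real.pi) ^ k
      = ((k : ℝ) + 1) ^ k / √((k : ℝ) + 1) / √(2 * Real.pi * ((k : ℝ) + 1) * (1 / 3)) ^ k := by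
  have hpi := Real.pi_pos
  have hprod : √(Real.pi / (1 / (6 * ((k : ℝ) + 1))))
      * √(2 * Real.pi * ((k : ℝ) + 1) * (1 / 3)) = (2 * Real.pi) * ((k : ℝ) + 1) := by
    rw [← Real.sqrt_mul (by positivity), Real.sqrt_eq_iff_mul_self_eq (by positivity) (by positivity)]
    field_simp
    ring
  have hs : 0 < √(2 * Real.pi * ((k : ℝ) + 1) * (1 / 3)) := Real.sqrt_pos.2 (by positivity)
  rw [div_div, div_div, div_eq_div_iff (by positivity) (by positivity)]
  calc _ = √((k : ℝ) + 1) * (√(Real.pi / (1 / (6 * ((k : ℝ) + 1))))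
        * √(2 * Real.pi * ((k : ℝ) + 1) * (1 / 3))) ^ k := by rw [mul_pow]; ring
    _ = _ := by rw [hprod, mul_pow]; ring

lemma cM_pos {M : ℕ} (hM : 1 ≤ M) : 0 < cM M := by
  have : (0 : ℝ) < M := by exact_mod_cast hM
  unfold cM
  positivity

lemma tendsto_pow_div_scale_atTop {k : ℕ} (M : ℕ → ℕ) (hM1 : ∀ n, 1 ≤ M n) {κ : ℝ}
    (hκ : Tendsto (fun n : ℕ => (n : ℝ) / Real.log (M n)) atTop (nhds κ))
    (hκgt : k < κ * Real.log (k + 1)) (hk : 1 ≤ k) :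
    Tendsto (fun n : ℕ => ((k : ℝ) + 1) ^ n / (M n * √n) ^ k) atTop atTop := by
  have hk1 : (1 : ℝ) ≤ k := by exact_mod_cast hk
  have hlog : 0 < Real.log ((k : ℝ) + 1) := Real.log_pos (by linarith)
  obtain ⟨p, hp1, hp2⟩ := exists_between ((div_lt_iff₀ hlog).2 hκgt)
  have hp0 : 0 < p := lt_trans (by positivity) hp1
  set b : ℝ := ((k : ℝ) + 1) * Real.exp (-(k / p)) with hb
  have hb1 : 1 < b := by
    have h1 : (k : ℝ) / p < Real.log ((k : ℝ) + 1) := by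
      rw [div_lt_iff₀ hlog] at hp1
      rw [div_lt_iff₀ hp0]
      linarith
    calc 1 = Real.exp (k / p) * Real.exp (-(k / p)) := by rw [← Real.exp_add]; simp
      _ < b := by
        rw [hb]
        gcongr
        rwa [← Real.lt_log_iff_exp_lt (by positivity)]
  have hbase : Tendsto (fun n : ℕ => b ^ n / (n : ℝ) ^ k) atTop atTop := by
    have h0 : Tendsto (fun n : ℕ => (n : ℝ) ^ k / b ^ n) atTop (nhdsWithin 0 (Set.Ioi 0)) := by
      refine tendsto_nhdsWithin_iff.2 ⟨tendsto_pow_const_div_const_pow_of_one_lt k hb1, ?_⟩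
      filter_upwards [eventually_gt_atTop 0] with n hn
      have : (0 : ℝ) < n := by exact_mod_cast hn
      exact Set.mem_Ioi.2 (by positivity)
    refine h0.inv_tendsto_nhdsGT_zero.congr fun n => ?_
    rw [Pi.inv_apply, inv_div]
  refine tendsto_atTop_mono' _ ?_ hbase
  filter_upwards [hκ.eventually_const_lt hp2, eventually_ge_atTop 1] with n hn hn1
  have hnR : (1 : ℝ) ≤ n := by exact_mod_cast hn1
  have hMpos : (0 : ℝ) < M n := by exact_mod_cast hM1 n
  have hlogM : 0 < Real.log (M n) := by
    by_contra h
    have : Real.log (M n) = 0 :=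
      le_antisymm (not_lt.1 h) (Real.log_nonneg (by exact_mod_cast hM1 n))
    rw [this, div_zero] at hn
    linarith
  have hMexp : (M n : ℝ) ≤ Real.exp (n / p) := by
    rw [← Real.log_le_iff_le_exp hMpos, le_div_iff₀ hp0]
    rw [lt_div_iff₀ hlogM] at hn
    linarith
  have hbn : b ^ n = ((k : ℝ) + 1) ^ n / Real.exp (n / p) ^ k := by
    rw [hb, mul_pow, ← Real.exp_nat_mul, ← Real.exp_nat_mul,
      div_eq_mul_inv (((k : ℝ) + 1) ^ n), ← Real.exp_neg]
    congr 2
    ring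
  have hs : 0 < √(n : ℝ) := Real.sqrt_pos.2 (by linarith)
  rw [hbn, div_div, ← mul_pow]
  gcongr
  exact Real.sqrt_le_iff.2 ⟨by linarith, by nlinarith⟩

theorem expected_number_asymptotics_nu_ge_four
    (ν : ℕ) (hν : 4 ≤ ν)
    (η : ℝ) (hη1 : 1 / ((ν : ℝ) - 1) < η) (hη2 : η < 2 * Real.log ν / ((ν : ℝ) - 1))
    (hηroot : Real.exp (((ν : ℝ) - 1) * η) = (ν : ℝ) * Real.exp 1 * η)
    (M : ℕ → ℕ) (hM1 : ∀ n, 1 ≤ M n)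
    (hMtop : Tendsto M atTop atTop)
    (hMO : ∃ C : ℝ, ∀ n : ℕ, Real.log (M n) ≤ C * n)
    (κ : ℝ)
    (hκ : Tendsto (fun n : ℕ => (n : ℝ) / Real.log (M n)) atTop (nhds κ))
    (hκgt : 2 / η < κ) (hκne : κ ≠ 2 * ((ν : ℝ) - 1)) :
    Tendsto
      (fun n => EZ ν n (M n) /
        ((ν : ℝ) ^ n / (M n : ℝ) ^ (ν - 1) *
          ((ν : ℝ) ^ ((ν : ℝ) - 3 / 2) /
            (2 * Real.pi * (ν : ℝ) * cM (M n) * n) ^ (((ν : ℝ) - 1) / 2))))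
      atTop (nhds 1) ∧
    Tendsto (fun n => EZ ν n (M n)) atTop atTop := by
  obtain ⟨k, rfl⟩ : ∃ k, ν = k + 1 := ⟨ν - 1, by omega⟩
  have hpi := Real.pi_pos
  have hk : 1 ≤ k := by omega
  have hk1 : (1 : ℝ) ≤ k := by exact_mod_cast hk
  have hcast : ((k + 1 : ℕ) : ℝ) = (k : ℝ) + 1 := by push_cast; rfl
  simp only [hcast, add_sub_cancel_right, Nat.add_sub_cancel] at hη1 hη2 ⊢
  have hscale := tendsto_EZ_mul_scale k M hM1 hMtop
  rw [gaussian_constant_eq] at hscale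
  set L : ℝ := ((k : ℝ) + 1) ^ k / √((k : ℝ) + 1)
    / √(2 * Real.pi * ((k : ℝ) + 1) * (1 / 3)) ^ k with hL
  have hLpos : 0 < L := by
    have : 0 < √(2 * Real.pi * ((k : ℝ) + 1) * (1 / 3)) := Real.sqrt_pos.2 (by positivity)
    positivity
  constructor
  · have hconst : Tendsto (fun n => ((k : ℝ) + 1) ^ k / √((k : ℝ) + 1)
        / √(2 * Real.pi * ((k : ℝ) + 1) * cM (M n)) ^ k) atTop (nhds L) := by
      refine tendsto_const_nhds.div ?_ ?_
      · exact ((Real.continuous_sqrt.tendsto _).comp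
          ((tendsto_cM.comp hMtop).const_mul _)).pow k
      · have : 0 < √(2 * Real.pi * ((k : ℝ) + 1) * (1 / 3)) := Real.sqrt_pos.2 (by positivity)
        positivity
    have h := hscale.div hconst hLpos.ne'
    rw [div_self hLpos.ne'] at h
    refine h.congr' ?_
    filter_upwards [eventually_ge_atTop 1] with n hn
    have hnpos : (0 : ℝ) < n := by exact_mod_cast hn
    have hMpos : (0 : ℝ) < M n := by exact_mod_cast hM1 n
    have hc := cM_pos (hM1 n)
    have hs : 0 < √(2 * Real.pi * ((k : ℝ) + 1) * cM (M n)) := Real.sqrt_pos.2 (by positivity)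
    have hsn : 0 < √(n : ℝ) := Real.sqrt_pos.2 hnpos
    rw [Pi.div_apply, rpow_natCast_div_two (by positivity), rpow_sub_three_halves,
      Real.sqrt_mul (by positivity) (n : ℝ), mul_pow, mul_pow]
    field_simp
  · have hη0 : 0 < η := lt_trans (by positivity) hη1
    have hκk : (k : ℝ) < κ * Real.log (k + 1) := by
      rw [lt_div_iff₀ (by linarith)] at hη2
      rw [div_lt_iff₀ hη0] at hκgt
      have hlog : 0 < Real.log ((k : ℝ) + 1) := Real.log_pos (by linarith)
      nlinarith
    have h := hscale.pos_mul_atTop hLpos (tendsto_pow_div_scale_atTop M hM1 hκ hκk hk)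
    refine h.congr' ?_
    filter_upwards [eventually_ge_atTop 1] with n hn
    have hnpos : (0 : ℝ) < n := by exact_mod_cast hn
    have hMpos : (0 : ℝ) < M n := by exact_mod_cast hM1 n
    have hsn : 0 < √(n : ℝ) := Real.sqrt_pos.2 hnpos
    field_simp
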